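/- arXiv:2009.01512 — 2 statements merged into one kernel-verified Lean document; each statement's English description precedes it below -/
import Mathlib

section
/- Let P be a finite set of n points in Euclidean space ℝ^d that is in general position. Then there exists an injective map f : P → ℝ (the real line) such that: (i) for every δ ≥ 0 and all p, q ∈ P, the points p and q lie in the same connected component of the δ-threshold graph on P if and only if f(p) and f(q) lie in the same connected component of the δ-threshold graph on the image f(P) ⊂ ℝ; and (ii) the image f(P) has exactly n − 1 topology-changing edges, and the lengths of the topology-changing edges of f(P), listed in increasing order, are equal to the lengths of the topology-changing edges of P, listed in increasing order. -/
open scoped Classical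

/-- The `δ`-threshold graph on a finite point set `P` in a metric space:
vertices are the points of `P`, with an edge between distinct points
`p, q` exactly when `dist p q ≤ δ`. -/
def threshGraph {X : Type*} [MetricSpace X] (P : Finset X) (δ : ℝ) : SimpleGraph P :=
  SimpleGraph.fromRel (fun p q => dist (p : X) (q : X) ≤ δ)

/-- The strict sub-threshold graph on `P`: an edge between distinct points
`p, q` exactly when `dist p q < ℓ`. -/
def strictGraph {X : Type*} [MetricSpace X] (P : Finset X) (ℓ : ℝ) : SimpleGraph P :=
  SimpleGraph.fromRel (fun p q => dist (p : X) (q : X) < ℓ)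

/-- `{p, q}` is a topology-changing edge of `P` if `p ≠ q` and `p` and `q` lie in
different connected components of the graph on `P` whose edges are the pairs of
distinct points at distance strictly less than `dist p q`. -/
def IsTopoEdge {X : Type*} [MetricSpace X] (P : Finset X) (p q : P) : Prop :=
  p ≠ q ∧ ¬ (strictGraph P (dist (p : X) (q : X))).Reachable p q

/-- The simple graph on `P` whose edges are exactly the topology-changing edges of `P`. -/
def topoGraph {X : Type*} [MetricSpace X] (P : Finset X) : SimpleGraph P :=
  SimpleGraph.fromRel (fun p q => IsTopoEdge P p q)

/-- `P` is in general position: the distances over all unordered pairs of distinct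
points of `P` are pairwise distinct. -/
def GenPos {X : Type*} [MetricSpace X] (P : Finset X) : Prop :=
  ∀ p q r s : P, p ≠ q → r ≠ s → dist (p : X) (q : X) = dist (r : X) (s : X) →
    (p = r ∧ q = s) ∨ (p = s ∧ q = r)

/-- The length (Euclidean distance between the endpoints) of an unordered pair of
points of `P`. -/
noncomputable def edgeLen {X : Type*} [MetricSpace X] (P : Finset X) : Sym2 P → ℝ :=
  Sym2.lift ⟨fun p q => dist (p : X) (q : X), fun _ _ => dist_comm _ _⟩


/-- Prim ordering of a finite point set. -/
structure PrimOrd {X : Type*} [MetricSpace X] (P : Finset X) (n : ℕ) (q : Fin n ≃ P)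
    (m : Fin n → Fin n) (g : Fin n → ℝ) : Prop where
  hm : ∀ b : Fin n, 0 < b.val → m b < b
  hd : ∀ b : Fin n, 0 < b.val → dist (q (m b) : X) (q b : X) = g b
  hc : ∀ a b c : Fin n, a < b → b ≤ c → g b ≤ dist (q a : X) (q c : X)

theorem prim_cut {X : Type*} [MetricSpace X] {P : Finset X} {n : ℕ} {q : Fin n ≃ P}
    {m : Fin n → Fin n} {g : Fin n → ℝ} (h : PrimOrd P n q m g) (Φ : ℝ → Prop)
    (hΦ : ∀ x y, x ≤ y → Φ y → Φ x) (G : SimpleGraph P)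
    (hG : ∀ p r : P, G.Adj p r → Φ (dist (p : X) (r : X)))
    {x y : P} (w : G.Walk x y) (t : Fin n) (hx : q.symm x < t) (hy : t ≤ q.symm y) :
    Φ (g t) := by
  induction w with
  | nil => exact absurd hx (not_lt.mpr hy)
  | @cons u v w huv p ih =>
    by_cases hv : q.symm v < t
    · exact ih hv hy
    · have := h.hc _ _ _ hx (not_lt.mp hv)
      simp only [Equiv.apply_symm_apply] at this
      exact hΦ _ _ this (hG _ _ huv)

theorem prim_reach {X : Type*} [MetricSpace X] {P : Finset X} {n : ℕ} {q : Fin n ≃ P}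
    {m : Fin n → Fin n} {g : Fin n → ℝ} (h : PrimOrd P n q m g) (Φ : ℝ → Prop)
    (hΦ : ∀ x y, x ≤ y → Φ y → Φ x) (G : SimpleGraph P)
    (hG : ∀ p r : P, p ≠ r → Φ (dist (p : X) (r : X)) → G.Adj p r) :
    ∀ (N : ℕ) (a b : Fin n), b.val ≤ N → a < b → (∀ t, a < t → t ≤ b → Φ (g t)) →
      G.Reachable (q a) (q b) := by
  intro N
  induction N with
  | zero => intro a b hb hab; exact absurd (Fin.lt_def.mp hab) (by omega)
  | succ N ih =>
    intro a b hb hab ht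
    have hb0 : 0 < b.val := lt_of_le_of_lt (Nat.zero_le _) (Fin.lt_def.mp hab)
    have hmb := h.hm b hb0
    have hdb := h.hd b hb0
    have hΦb := ht b hab le_rfl
    have hadj : G.Adj (q (m b)) (q b) :=
      hG _ _ (fun he => hmb.ne (q.injective he)) (by rw [hdb]; exact hΦb)
    refine SimpleGraph.Reachable.trans ?_ hadj.reachable
    rcases lt_trichotomy (m b) a with h1 | h1 | h1
    · refine (ih (m b) a ?_ h1 ?_).symm
      · have := Fin.lt_def.mp hab; omega
      · intro t h2 h3
        refine hΦ _ _ ?_ hΦb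
        rw [← hdb]
        exact h.hc _ _ _ h2 (h3.trans hab.le)
    · rw [h1]
    · refine ih a (m b) ?_ h1 ?_
      · have := Fin.lt_def.mp hmb; omega
      · intro t h2 h3
        exact ht t h2 (h3.trans hmb.le)

theorem thresh_adj {X : Type*} [MetricSpace X] (P : Finset X) (δ : ℝ) (p r : P) :
    (threshGraph P δ).Adj p r ↔ p ≠ r ∧ dist (p : X) (r : X) ≤ δ := by
  simp [threshGraph, dist_comm (r : X) (p : X)]

theorem strict_adj {X : Type*} [MetricSpace X] (P : Finset X) (δ : ℝ) (p r : P) :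
    (strictGraph P δ).Adj p r ↔ p ≠ r ∧ dist (p : X) (r : X) < δ := by
  simp [strictGraph, dist_comm (r : X) (p : X)]

theorem topoEdge_symm {X : Type*} [MetricSpace X] {P : Finset X} {p r : P}
    (h : IsTopoEdge P p r) : IsTopoEdge P r p := by
  refine ⟨h.1.symm, fun hr => h.2 ?_⟩
  rw [dist_comm]
  exact hr.symm

theorem topo_adj {X : Type*} [MetricSpace X] (P : Finset X) (p r : P) :
    (topoGraph P).Adj p r ↔ IsTopoEdge P p r := by
  simp only [topoGraph, SimpleGraph.fromRel_adj]
  constructor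
  · rintro ⟨-, h | h⟩
    · exact h
    · exact topoEdge_symm h
  · intro h
    exact ⟨h.1, Or.inl h⟩

theorem prim_thresh {X : Type*} [MetricSpace X] {P : Finset X} {n : ℕ} {q : Fin n ≃ P}
    {m : Fin n → Fin n} {g : Fin n → ℝ} (h : PrimOrd P n q m g) (δ : ℝ) (a b : Fin n)
    (hab : a < b) :
    (threshGraph P δ).Reachable (q a) (q b) ↔ ∀ t, a < t → t ≤ b → g t ≤ δ := by
  constructor
  · rintro ⟨w⟩ t h1 h2
    exact prim_cut h (fun x => x ≤ δ) (fun _ _ => le_trans) _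
      (fun p r hh => ((thresh_adj P δ p r).1 hh).2) w t (by simpa using h1) (by simpa using h2)
  · exact prim_reach h (fun x => x ≤ δ) (fun _ _ => le_trans) _
      (fun p r h1 h2 => (thresh_adj P δ p r).2 ⟨h1, h2⟩) _ a b le_rfl hab

theorem prim_strict {X : Type*} [MetricSpace X] {P : Finset X} {n : ℕ} {q : Fin n ≃ P}
    {m : Fin n → Fin n} {g : Fin n → ℝ} (h : PrimOrd P n q m g) (δ : ℝ) (a b : Fin n)
    (hab : a < b) :
    (strictGraph P δ).Reachable (q a) (q b) ↔ ∀ t, a < t → t ≤ b → g t < δ := by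
  constructor
  · rintro ⟨w⟩ t h1 h2
    exact prim_cut h (fun x => x < δ) (fun _ _ => lt_of_le_of_lt) _
      (fun p r hh => ((strict_adj P δ p r).1 hh).2) w t (by simpa using h1) (by simpa using h2)
  · exact prim_reach h (fun x => x < δ) (fun _ _ => lt_of_le_of_lt) _
      (fun p r h1 h2 => (strict_adj P δ p r).2 ⟨h1, h2⟩) _ a b le_rfl hab

theorem prim_topo {X : Type*} [MetricSpace X] {P : Finset X} {n : ℕ} {q : Fin n ≃ P}
    {m : Fin n → Fin n} {g : Fin n → ℝ} (h : PrimOrd P n q m g) (b : Fin n) (hb : 0 < b.val) :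
    IsTopoEdge P (q (m b)) (q b) := by
  have hm := h.hm b hb
  refine ⟨fun he => hm.ne (q.injective he), fun hr => ?_⟩
  rw [prim_strict h _ _ _ hm] at hr
  have := hr b hm le_rfl
  rw [h.hd b hb] at this
  exact lt_irrefl _ this

theorem prim_equiv {X : Type*} [MetricSpace X] {P : Finset X} {n : ℕ} {q : Fin n ≃ P}
    {m : Fin n → Fin n} {g : Fin n → ℝ} (h : PrimOrd P n q m g)
    (hU : ∀ i j : Fin n, i < j → IsTopoEdge P (q i) (q j) → i = m j) :
    ∃ E : {b : Fin n // 0 < b.val} ≃ (topoGraph P).edgeSet,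
      ∀ b, edgeLen P (E b : Sym2 P) = g b := by
  let F : {b : Fin n // 0 < b.val} → (topoGraph P).edgeSet := fun b =>
    ⟨s(q (m b), q b), by
      rw [SimpleGraph.mem_edgeSet, topo_adj]; exact prim_topo h b.1 b.2⟩
  have hF : Function.Bijective F := by
    constructor
    · rintro ⟨b, hb⟩ ⟨c, hc⟩ hbc
      have h1 : s(q (m b), q b) = s(q (m c), q c) := congrArg Subtype.val hbc
      rw [Sym2.eq_iff] at h1
      simp only [EmbeddingLike.apply_eq_iff_eq] at h1
      rcases h1 with h1 | h1
      · exact Subtype.ext h1.2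
      · have h2 := h.hm b hb
        have h3 := h.hm c hc
        rw [h1.1, h1.2] at h2
        exact absurd h2 h3.asymm
    · rintro ⟨e, he⟩
      induction e using Sym2.ind with
      | _ x y =>
        obtain ⟨i, rfl⟩ := q.surjective x
        obtain ⟨j, rfl⟩ := q.surjective y
        rw [SimpleGraph.mem_edgeSet, topo_adj] at he
        rcases lt_trichotomy i j with hij | hij | hij
        · have := hU i j hij he
          refine ⟨⟨j, lt_of_le_of_lt (Nat.zero_le _) (Fin.lt_def.mp hij)⟩, ?_⟩
          apply Subtype.ext
          simp only [F]
          rw [← this]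
        · exact absurd (congrArg q hij) he.1
        · have := hU j i hij (topoEdge_symm he)
          refine ⟨⟨i, lt_of_le_of_lt (Nat.zero_le _) (Fin.lt_def.mp hij)⟩, ?_⟩
          apply Subtype.ext
          simp only [F]
          rw [← this, Sym2.eq_swap]
  refine ⟨Equiv.ofBijective F hF, fun b => ?_⟩
  exact h.hd b.1 b.2

theorem prim_seq {X : Type*} [MetricSpace X] (P : Finset X) (p0 : P) (k : ℕ) (hk : k ≤ P.card) :
    ∃ q : ℕ → P, (∀ i j, i < j → j < k → q i ≠ q j) ∧
      ∀ b, 0 < b → b < k → ∃ m < b, ∀ a < b, ∀ y : P, (∀ i < b, q i ≠ y) →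
        dist (q m : X) (q b : X) ≤ dist (q a : X) (y : X) := by
  induction k with
  | zero => exact ⟨fun _ => p0, by omega, by omega⟩
  | succ k ih =>
    obtain ⟨q, h1, h2⟩ := ih (by omega)
    have hex : ∃ y : P, ∀ i < k, q i ≠ y := by
      by_contra hcon
      push Not at hcon
      have hsub : (Finset.univ : Finset P) ⊆ (Finset.range k).image q := by
        intro y _
        obtain ⟨i, hi, hy⟩ := hcon y
        exact Finset.mem_image.2 ⟨i, Finset.mem_range.2 hi, hy⟩
      have := (Finset.card_le_card hsub).trans Finset.card_image_le
      simp at this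
      omega
    have hz : ∃ z : P, (∀ i < k, q i ≠ z) ∧ (0 < k → ∃ m < k, ∀ a < k, ∀ y : P,
        (∀ i < k, q i ≠ y) → dist (q m : X) (z : X) ≤ dist (q a : X) (y : X)) := by
      obtain ⟨y, hy⟩ := hex
      by_cases hk0 : 0 < k
      · obtain ⟨⟨m, z⟩, hmz, hmin⟩ := Finset.exists_min_image
          ((Finset.range k) ×ˢ (Finset.univ.filter fun y : P => ∀ i < k, q i ≠ y))
          (fun x => dist (q x.1 : X) (x.2 : X)) ⟨(0, y), by simpa [hk0] using hy⟩
        simp only [Finset.mem_product, Finset.mem_range, Finset.mem_filter, Finset.mem_univ,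
          true_and] at hmz hmin
        refine ⟨z, hmz.2, fun _ => ⟨m, hmz.1, fun a ha y hy => ?_⟩⟩
        exact hmin (a, y) ⟨ha, hy⟩
      · exact ⟨y, hy, fun h => absurd h hk0⟩
    obtain ⟨z, hz1, hz2⟩ := hz
    have hlt : ∀ i, i < k → Function.update q k z i = q i := fun i hi =>
      Function.update_of_ne (by omega) _ _
    have hkk : Function.update q k z k = z := Function.update_self _ _ _
    refine ⟨Function.update q k z, ?_, ?_⟩
    · intro i j hij hj
      rcases Nat.lt_succ_iff_lt_or_eq.mp hj with hj | rfl
      · rw [hlt i (by omega), hlt j hj]; exact h1 i j hij hj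
      · rw [hlt i hij, hkk]; exact hz1 i hij
    · intro b hb0 hb
      rcases Nat.lt_succ_iff_lt_or_eq.mp hb with hb | rfl
      · obtain ⟨m, hm, hmm⟩ := h2 b hb0 hb
        refine ⟨m, hm, fun a ha y hy => ?_⟩
        rw [hlt m (by omega), hlt a (by omega), hlt b hb]
        exact hmm a ha y fun i hi => by rw [← hlt i (by omega)]; exact hy i hi
      · obtain ⟨m, hm, hmm⟩ := hz2 hb0
        refine ⟨m, hm, fun a ha y hy => ?_⟩
        rw [hlt m hm, hlt a ha, hkk]
        exact hmm a ha y fun i hi => by rw [← hlt i (by omega)]; exact hy i hi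

theorem prim_exists {X : Type*} [MetricSpace X] (P : Finset X) :
    ∃ (q : Fin P.card ≃ P) (m : Fin P.card → Fin P.card) (g : Fin P.card → ℝ),
      PrimOrd P P.card q m g := by
  rcases P.eq_empty_or_nonempty with rfl | ⟨p0, hp0⟩
  · exact ⟨(Finset.equivFin _).symm, id, fun _ => 0, ⟨fun b => b.elim0, fun b => b.elim0,
      fun b => b.elim0⟩⟩
  obtain ⟨q, h1, h2⟩ := prim_seq P ⟨p0, hp0⟩ P.card le_rfl
  have hinj : Function.Injective (fun i : Fin P.card => q i) := by
    intro i j hij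
    rcases lt_trichotomy i j with h | h | h
    · exact absurd hij (h1 i j h j.2)
    · exact h
    · exact absurd hij.symm (h1 j i h i.2)
  have hbij : Function.Bijective (fun i : Fin P.card => q i) :=
    (Fintype.bijective_iff_injective_and_card _).2 ⟨hinj, by simp⟩
  have h3 : ∀ b : Fin P.card, ∃ m : Fin P.card, 0 < b.val → m < b ∧ ∀ a < b, ∀ y : P,
      (∀ i < b, q i ≠ y) → dist (q m : X) (q b : X) ≤ dist (q a : X) (y : X) := by
    intro b
    by_cases hb : 0 < b.val
    · obtain ⟨m, hm, hmm⟩ := h2 b hb b.2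
      refine ⟨⟨m, hm.trans b.2⟩, fun _ => ⟨hm, fun a ha y hy => hmm a ha y fun i hi => ?_⟩⟩
      exact hy ⟨i, hi.trans b.2⟩ hi
    · exact ⟨b, fun h => absurd h hb⟩
  choose m hm using h3
  refine ⟨Equiv.ofBijective _ hbij, m, fun b => dist (q (m b) : X) (q b : X), ?_, ?_, ?_⟩
  · intro b hb
    exact (hm b hb).1
  · intro b hb
    rfl
  · intro a b c hab hbc
    refine (hm b (lt_of_le_of_lt (Nat.zero_le _) (Fin.lt_def.mp hab))).2 a hab (q c) ?_
    intro i hi he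
    exact (hi.trans_le hbc).ne (hinj he)

theorem prim_unique {X : Type*} [MetricSpace X] {P : Finset X} {n : ℕ} {q : Fin n ≃ P}
    {m : Fin n → Fin n} {g : Fin n → ℝ} (h : PrimOrd P n q m g) (hgp : GenPos P) :
    ∀ i j : Fin n, i < j → IsTopoEdge P (q i) (q j) → i = m j := by
  intro i j hij ht
  have h1 := ht.2
  rw [prim_strict h _ _ _ hij] at h1
  push Not at h1
  obtain ⟨t, hit, htj, hle⟩ := h1
  have ht0 : 0 < t.val := lt_of_le_of_lt (Nat.zero_le _) (Fin.lt_def.mp hit)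
  have heq := le_antisymm (h.hc i t j hit htj) hle
  rw [← h.hd t ht0] at heq
  have hm := h.hm t ht0
  rcases hgp _ _ _ _ (fun he => hm.ne (q.injective he)) ht.1 heq with ⟨ha, hb⟩ | ⟨ha, hb⟩
  · rw [← q.injective ha, ← q.injective hb]
  · have ha := q.injective ha
    have hb := q.injective hb
    rw [ha, hb] at hm
    exact absurd hm hij.asymm

/-- **one-dimensional Proposition 1.** For `P` of `n` points in
`ℝ^d` in general position, there is an injective map `f : P → ℝ` such that:
(i) for every `δ ≥ 0`, two points of `P` lie in the same connected component of the
`δ`-threshold graph on `P` iff their images do in the `δ`-threshold graph on `f(P)`;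
(ii) `f(P)` has exactly `n - 1` topology-changing edges and there is a
length-preserving bijection between the topology-changing edges of `P` and those of
`f(P)` (so their length lists in increasing order coincide). -/
theorem topomap_exists_1d {d : ℕ} (P : Finset (EuclideanSpace ℝ (Fin d)))
    (hgp : GenPos P) :
    ∃ f : EuclideanSpace ℝ (Fin d) → ℝ,
      Set.InjOn f ↑P ∧
      (∀ δ : ℝ, 0 ≤ δ → ∀ p q : P,
        (threshGraph P δ).Reachable p q ↔
        (threshGraph (P.image f) δ).Reachable
          ⟨f p, Finset.mem_image_of_mem f p.2⟩
          ⟨f q, Finset.mem_image_of_mem f q.2⟩) ∧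
      (topoGraph (P.image f)).edgeSet.ncard = P.card - 1 ∧
      ∃ g : (topoGraph P).edgeSet ≃ (topoGraph (P.image f)).edgeSet,
        ∀ e : (topoGraph P).edgeSet,
          edgeLen (P.image f) (g e : Sym2 (P.image f)) = edgeLen P (e : Sym2 P) := by
  obtain ⟨q, m, g, h⟩ := prim_exists P
  have hg : ∀ b : Fin P.card, 0 < b.val → 0 < g b := by
    intro b hb
    rw [← h.hd b hb, dist_pos]
    intro he
    exact (h.hm b hb).ne (q.injective (Subtype.ext he))
  let S : Fin P.card → ℝ := fun i => ∑ t ∈ Finset.univ.filter (fun t => 0 < t.val ∧ t ≤ i), g t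
  have hS : ∀ i j : Fin P.card, i < j → S j - S i = ∑ t ∈ Finset.Ioc i j, g t := by
    intro i j hij
    have hu : Finset.univ.filter (fun t : Fin P.card => 0 < t.val ∧ t ≤ j) =
        Finset.univ.filter (fun t : Fin P.card => 0 < t.val ∧ t ≤ i) ∪ Finset.Ioc i j := by
      ext t
      simp only [Finset.mem_filter, Finset.mem_univ, true_and, Finset.mem_union, Finset.mem_Ioc,
        Fin.lt_def, Fin.le_def] at *
      omega
    have hdj : Disjoint (Finset.univ.filter (fun t : Fin P.card => 0 < t.val ∧ t ≤ i))
        (Finset.Ioc i j) := by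
      rw [Finset.disjoint_left]
      intro t
      simp only [Finset.mem_filter, Finset.mem_univ, true_and, Finset.mem_Ioc,
        Fin.lt_def, Fin.le_def] at *
      omega
    simp only [S]
    rw [hu, Finset.sum_union hdj]
    ring
  have hpos : ∀ i j t : Fin P.card, t ∈ Finset.Ioc i j → 0 < g t := by
    intro i j t ht
    exact hg t (lt_of_le_of_lt (Nat.zero_le _) (Fin.lt_def.mp (Finset.mem_Ioc.1 ht).1))
  have hSlt : ∀ i j : Fin P.card, i < j → S i < S j := by
    intro i j hij
    have : 0 < ∑ t ∈ Finset.Ioc i j, g t :=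
      Finset.sum_pos (hpos i j) ⟨j, Finset.mem_Ioc.2 ⟨hij, le_rfl⟩⟩
    linarith [hS i j hij]
  have hSd : ∀ i j : Fin P.card, i < j → dist (S i) (S j) = ∑ t ∈ Finset.Ioc i j, g t := by
    intro i j hij
    rw [dist_comm, Real.dist_eq, abs_of_pos (by linarith [hSlt i j hij]), hS i j hij]
  have hSinj : Function.Injective S := (show StrictMono S from fun i j => hSlt i j).injective
  let f : EuclideanSpace ℝ (Fin d) → ℝ := fun x => if hx : x ∈ P then S (q.symm ⟨x, hx⟩) else 0
  have hf : ∀ p : P, f p = S (q.symm p) := by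
    intro p
    simp [f]
  have hfinj : Set.InjOn f ↑P := by
    intro x hx y hy hxy
    have h1 := hf ⟨x, hx⟩
    have h2 := hf ⟨y, hy⟩
    have h3 : S (q.symm ⟨x, hx⟩) = S (q.symm ⟨y, hy⟩) := by rw [← h1, ← h2]; exact hxy
    exact congrArg Subtype.val (q.symm.injective (hSinj h3))
  let r : Fin P.card → P.image f := fun i => ⟨f (q i), Finset.mem_image_of_mem f (q i).2⟩
  have hr : Function.Bijective r := by
    constructor
    · intro i j hij
      have h1 : f (q i) = f (q j) := congrArg Subtype.val hij
      exact q.injective (Subtype.ext (hfinj (q i).2 (q j).2 h1))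
    · rintro ⟨y, hy⟩
      obtain ⟨x, hx, rfl⟩ := Finset.mem_image.1 hy
      exact ⟨q.symm ⟨x, hx⟩, by simp [r]⟩
  let q' : Fin P.card ≃ P.image f := Equiv.ofBijective r hr
  have hq' : ∀ i, ((q' i : P.image f) : ℝ) = S i := by
    intro i
    change f (q i) = S i
    rw [hf]
    simp
  let m' : Fin P.card → Fin P.card := fun b => ⟨b.val - 1, by omega⟩
  have h' : PrimOrd (P.image f) P.card q' m' g := by
    refine ⟨?_, ?_, ?_⟩
    · intro b hb
      simp only [m', Fin.lt_def]
      omega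
    · intro b hb
      have hlt : m' b < b := by simp only [m', Fin.lt_def]; omega
      rw [hq', hq', hSd _ _ hlt]
      have : Finset.Ioc (m' b) b = {b} := by
        ext t
        simp only [Finset.mem_Ioc, Finset.mem_singleton, m', Fin.lt_def, Fin.le_def, Fin.ext_iff]
        omega
      rw [this, Finset.sum_singleton]
    · intro a b c hab hbc
      rw [hq', hq', hSd _ _ (hab.trans_le hbc)]
      exact Finset.single_le_sum (f := g) (fun t ht => (hpos a c t ht).le)
        (Finset.mem_Ioc.2 ⟨hab, hbc⟩)
  have hU' : ∀ i j : Fin P.card, i < j → IsTopoEdge (P.image f) (q' i) (q' j) → i = m' j := by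
    intro i j hij ht
    by_contra hne
    apply ht.2
    rw [prim_strict h' _ _ _ hij, hq', hq', hSd _ _ hij]
    intro t h1 h2
    have hex : ∃ s ∈ Finset.Ioc i j, s ≠ t := by
      by_cases htj : t = j
      · refine ⟨m' j, ?_, ?_⟩
        · simp only [Finset.mem_Ioc, m', Fin.lt_def, Fin.le_def, Fin.ext_iff] at *
          omega
        · simp only [m', Fin.lt_def, Fin.le_def, Fin.ext_iff, ne_eq] at *
          omega
      · exact ⟨j, Finset.mem_Ioc.2 ⟨hij, le_rfl⟩, fun h => htj h.symm⟩
    obtain ⟨s, hs, hst⟩ := hex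
    exact Finset.single_lt_sum hst (Finset.mem_Ioc.2 ⟨h1, h2⟩) hs (hpos i j s hs)
      (fun k hk _ => (hpos i j k hk).le)
  obtain ⟨E, hE⟩ := prim_equiv h (prim_unique h hgp)
  obtain ⟨E', hE'⟩ := prim_equiv h' hU'
  refine ⟨f, hfinj, ?_, ?_, E.symm.trans E', ?_⟩
  · intro δ hδ p s
    obtain ⟨i, rfl⟩ := q.surjective p
    obtain ⟨j, rfl⟩ := q.surjective s
    change _ ↔ (threshGraph (P.image f) δ).Reachable (q' i) (q' j)
    rcases lt_trichotomy i j with hij | rfl | hij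
    · rw [prim_thresh h _ _ _ hij, prim_thresh h' _ _ _ hij]
    · exact ⟨fun _ => SimpleGraph.Reachable.refl _, fun _ => SimpleGraph.Reachable.refl _⟩
    · rw [SimpleGraph.reachable_comm, prim_thresh h _ _ _ hij, SimpleGraph.reachable_comm,
        prim_thresh h' _ _ _ hij]
  · rw [← Nat.card_coe_set_eq, ← Nat.card_congr E']
    rcases Nat.eq_zero_or_pos P.card with h0 | h0
    · have : IsEmpty {b : Fin P.card // 0 < b.val} := ⟨fun b => by have := b.1.2; omega⟩
      rw [Nat.card_of_isEmpty, h0]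
    · rw [Nat.card_eq_fintype_card, Fintype.card_subtype]
      have : Finset.univ.filter (fun b : Fin P.card => 0 < b.val) =
          Finset.univ.erase ⟨0, h0⟩ := by
        ext b
        simp [Fin.ext_iff, Nat.pos_iff_ne_zero]
      rw [this, Finset.card_erase_of_mem (Finset.mem_univ _), Finset.card_univ, Fintype.card_fin]
  · intro e
    obtain ⟨b, rfl⟩ := E.surjective e
    simp only [Equiv.trans_apply, Equiv.symm_apply_apply]
    rw [hE, hE']
end

section
/- Let P be a finite set of points in Euclidean space ℝ^d that is in general position. Then there exists an injective map f : P → ℝ² such that for all distinct p, q ∈ P, the least δ ≥ 0 at which p and q lie in the same connected component of the δ-threshold graph on P equals the least δ ≥ 0 at which f(p) and f(q) lie in the same connected component of the δ-threshold graph on the image f(P) ⊂ ℝ². -/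
open scoped Classical

/-- A finite ultrametric can be realised by single linkage on the real line. -/
theorem line_embed {α : Type*} (u : α → α → ℝ)
    (hsymm : ∀ a b, u a b = u b a)
    (hpos : ∀ a b, a ≠ b → 0 < u a b)
    (hult : ∀ a b c, u a c ≤ max (u a b) (u b c)) :
    ∀ (n : ℕ) (S : Finset α), S.card = n → ∃ g : α → ℝ,
      (∀ a ∈ S, ∀ b ∈ S, a ≠ b → u a b ≤ |g a - g b|) ∧
      (∀ a ∈ S, ∀ b ∈ S, a ≠ b →
        Relation.ReflTransGen (fun x y => x ∈ S ∧ y ∈ S ∧ |g x - g y| ≤ u a b) a b) := by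
  intro n
  induction n with
  | zero =>
    intro S hS
    rw [Finset.card_eq_zero] at hS
    subst hS
    exact ⟨fun _ => 0, by simp, by simp⟩
  | succ n ih =>
    intro S hS
    by_cases hne : S.offDiag.Nonempty
    swap
    · refine ⟨fun _ => 0, ?_, ?_⟩
      · intro a ha b hb hab
        exact absurd ⟨(a, b), by simp [ha, hb, hab]⟩ hne
      · intro a ha b hb hab
        exact absurd ⟨(a, b), by simp [ha, hb, hab]⟩ hne
    obtain ⟨⟨x, y⟩, hxy, hmin⟩ := Finset.exists_min_image S.offDiag (fun p => u p.1 p.2) hne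
    rw [Finset.mem_offDiag] at hxy
    obtain ⟨hx, hy, hne'⟩ := hxy
    simp only at hx hy hne' hmin
    have hmin' : ∀ a ∈ S, ∀ b ∈ S, a ≠ b → u x y ≤ u a b := fun a ha b hb hab =>
      hmin (a, b) (by simp [ha, hb, hab])
    obtain ⟨g, h1, h2⟩ := ih (S.erase x) (by rw [Finset.card_erase_of_mem hx, hS]; rfl)
    have hyS : y ∈ S.erase x := Finset.mem_erase.2 ⟨hne'.symm, hy⟩
    have hr : 0 < u x y := hpos x y hne'
    have hxz : ∀ z ∈ S, z ≠ x → z ≠ y → u x z = u y z := by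
      intro z hz hzx hzy
      apply le_antisymm
      · refine (hult x y z).trans (max_le (hmin' y hy z hz (Ne.symm hzy)) le_rfl)
      · refine (hult y x z).trans (max_le ?_ le_rfl)
        rw [hsymm y x]
        exact hmin' x hx z hz (Ne.symm hzx)
    set G : α → ℝ := fun z => if z = x then g y + u x y else
      if g z ≤ g y then g z else g z + u x y with hG
    have Gx : G x = g y + u x y := by simp [hG]
    have Gle : ∀ z, z ≠ x → g z ≤ g y → G z = g z := by
      intro z hz h; simp [hG, hz, h]
    have Ggt : ∀ z, z ≠ x → g y < g z → G z = g z + u x y := by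
      intro z hz h; simp [hG, hz, not_le.2 h]
    have Gy : G y = g y := Gle y hne'.symm le_rfl
    have I1x : ∀ z ∈ S, z ≠ x → u x z ≤ |G x - G z| := by
      intro z hz hzx
      by_cases hzy : z = y
      · subst hzy
        rw [Gx, Gy]
        exact le_trans (by linarith) (le_abs_self _)
      have hh := h1 y hyS z (Finset.mem_erase.2 ⟨hzx, hz⟩) (Ne.symm hzy)
      rw [hxz z hz hzx hzy]
      rcases le_or_gt (g z) (g y) with h | h
      · rw [Gx, Gle z hzx h]
        rw [abs_of_nonneg (by linarith)] at hh
        exact le_trans (by linarith) (le_abs_self _)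
      · rw [Gx, Ggt z hzx h]
        rw [abs_of_neg (by linarith)] at hh
        exact le_trans (by linarith) (neg_le_abs _)
    have lift : ∀ δ, u x y ≤ δ → ∀ a b,
        Relation.ReflTransGen (fun p q => p ∈ S.erase x ∧ q ∈ S.erase x ∧ |g p - g q| ≤ δ) a b →
        Relation.ReflTransGen (fun p q => p ∈ S ∧ q ∈ S ∧ |G p - G q| ≤ δ) a b := by
      intro δ hδ a b hab
      have hxyδ : |G x - G y| ≤ δ := by
        rw [Gx, Gy, abs_le]; constructor <;> linarith
      have hyxδ : |G y - G x| ≤ δ := by rw [abs_sub_comm]; exact hxyδ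
      induction hab with
      | refl => exact Relation.ReflTransGen.refl
      | @tail w z _ hwz ihh =>
        refine ihh.trans ?_
        obtain ⟨hw, hz, hd⟩ := hwz
        rw [Finset.mem_erase] at hw hz
        obtain ⟨hwx, hw⟩ := hw
        obtain ⟨hzx, hz⟩ := hz
        rw [abs_le] at hd
        rcases le_or_gt (g w) (g y) with h | h <;> rcases le_or_gt (g z) (g y) with h' | h'
        · refine Relation.ReflTransGen.single ⟨hw, hz, ?_⟩
          rw [Gle w hwx h, Gle z hzx h', abs_le]; exact hd
        · refine ((Relation.ReflTransGen.single ⟨hw, hy, ?_⟩).tail ⟨hy, hx, hyxδ⟩).tail ⟨hx, hz, ?_⟩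
          · rw [Gx, Ggt z hzx h', abs_le]; constructor <;> linarith
          · rw [Gle w hwx h, Gy, abs_le]; constructor <;> linarith
        · refine ((Relation.ReflTransGen.single ⟨hw, hx, ?_⟩).tail ⟨hx, hy, hxyδ⟩).tail ⟨hy, hz, ?_⟩
          · rw [Gy, Gle z hzx h', abs_le]; constructor <;> linarith
          · rw [Ggt w hwx h, Gx, abs_le]; constructor <;> linarith
        · refine Relation.ReflTransGen.single ⟨hw, hz, ?_⟩
          rw [Ggt w hwx h, Ggt z hzx h', abs_le]; constructor <;> linarith
    have I2x : ∀ z ∈ S, z ≠ x →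
        Relation.ReflTransGen (fun p q => p ∈ S ∧ q ∈ S ∧ |G p - G q| ≤ u x z) x z := by
      intro z hz hzx
      have hδ : u x y ≤ u x z := hmin' x hx z hz (Ne.symm hzx)
      have hs : |G x - G y| ≤ u x z := by
        rw [Gx, Gy, abs_le]; constructor <;> linarith
      by_cases hzy : z = y
      · subst hzy
        exact Relation.ReflTransGen.single ⟨hx, hy, hs⟩
      · refine Relation.ReflTransGen.head ⟨hx, hy, hs⟩ (lift _ hδ _ _ ?_)
        rw [hxz z hz hzx hzy]
        exact h2 y hyS z (Finset.mem_erase.2 ⟨hzx, hz⟩) (Ne.symm hzy)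
    refine ⟨G, ?_, ?_⟩
    · intro a ha b hb hab
      by_cases hax : a = x
      · subst hax; exact I1x b hb (Ne.symm hab)
      by_cases hbx : b = x
      · subst hbx; rw [hsymm, abs_sub_comm]; exact I1x a ha hab
      have hh := h1 a (Finset.mem_erase.2 ⟨hax, ha⟩) b (Finset.mem_erase.2 ⟨hbx, hb⟩) hab
      refine hh.trans ?_
      rcases le_or_gt (g a) (g y) with h | h <;> rcases le_or_gt (g b) (g y) with h' | h'
      · rw [Gle a hax h, Gle b hbx h']
      · rw [Gle a hax h, Ggt b hbx h', abs_of_neg (by linarith)]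
        exact le_trans (by linarith) (neg_le_abs _)
      · rw [Ggt a hax h, Gle b hbx h', abs_of_pos (by linarith)]
        exact le_trans (by linarith) (le_abs_self _)
      · rw [Ggt a hax h, Ggt b hbx h']
        simp
    · intro a ha b hb hab
      by_cases hax : a = x
      · subst hax; exact I2x b hb (Ne.symm hab)
      by_cases hbx : b = x
      · subst hbx
        have := I2x a ha hab
        rw [hsymm a b]
        rw [← Relation.reflTransGen_swap]
        refine Relation.ReflTransGen.mono ?_ _ _ this
        rintro p q ⟨hp, hq, hpq⟩
        exact ⟨hq, hp, by rw [abs_sub_comm]; exact hpq⟩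
      · exact lift _ (hmin' a ha b hb hab) _ _
          (h2 a (Finset.mem_erase.2 ⟨hax, ha⟩) b (Finset.mem_erase.2 ⟨hbx, hb⟩) hab)

theorem threshGraph_adj {X : Type*} [MetricSpace X] (P : Finset X) (δ : ℝ) (p q : P) :
    (threshGraph P δ).Adj p q ↔ p ≠ q ∧ dist (p : X) (q : X) ≤ δ := by
  simp only [threshGraph, SimpleGraph.fromRel_adj, dist_comm (q : X) (p : X), or_self]

theorem reach_of_dist {X : Type*} [MetricSpace X] (P : Finset X) (δ : ℝ) (p q : P)
    (h : dist (p : X) (q : X) ≤ δ) : (threshGraph P δ).Reachable p q := by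
  by_cases hpq : p = q
  · subst hpq; exact SimpleGraph.Reachable.refl _
  · exact SimpleGraph.Adj.reachable ((threshGraph_adj P δ p q).2 ⟨hpq, h⟩)

theorem reach_mono {X : Type*} [MetricSpace X] (P : Finset X) {δ ε : ℝ} (h : δ ≤ ε) (p q : P)
    (hr : (threshGraph P δ).Reachable p q) : (threshGraph P ε).Reachable p q := by
  refine hr.mono ?_
  intro a b hab
  rw [threshGraph_adj] at hab ⊢
  exact ⟨hab.1, hab.2.trans h⟩

/-- Merge times exist and are attained. -/
theorem exists_merge {X : Type*} [MetricSpace X] (P : Finset X) (p q : P) :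
    ∃ m : ℝ, 0 ≤ m ∧ ∀ δ : ℝ, 0 ≤ δ → ((threshGraph P δ).Reachable p q ↔ m ≤ δ) := by
  let D : Finset ℝ := (Finset.univ : Finset (P × P)).image
    (fun e => dist (e.1 : X) (e.2 : X))
  let R : Finset ℝ := D.filter (fun δ => (threshGraph P δ).Reachable p q)
  have hR : R.Nonempty := ⟨dist (p : X) (q : X), by
    simp only [R, D, Finset.mem_filter, Finset.mem_image, Finset.mem_univ, true_and]
    exact ⟨⟨(p, q), rfl⟩, reach_of_dist P _ p q le_rfl⟩⟩
  have hm := Finset.min'_mem R hR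
  have hm2 := (Finset.mem_filter.1 hm).2
  refine ⟨R.min' hR, ?_, ?_⟩
  · obtain ⟨e, -, he⟩ := Finset.mem_image.1 (Finset.mem_filter.1 hm).1
    rw [← he]; exact dist_nonneg
  · intro δ hδ
    refine ⟨fun hr => ?_, fun h => reach_mono P h p q hm2⟩
    let L : Finset ℝ := D.filter (fun t => t ≤ δ)
    have hL : L.Nonempty := ⟨0, by
      simp only [L, D, Finset.mem_filter, Finset.mem_image, Finset.mem_univ, true_and]
      exact ⟨⟨(p, p), dist_self _⟩, hδ⟩⟩
    have hM := Finset.mem_filter.1 (Finset.max'_mem L hL)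
    refine le_trans (Finset.min'_le R (L.max' hL) ?_) hM.2
    refine Finset.mem_filter.2 ⟨hM.1, hr.mono ?_⟩
    intro a b hab
    rw [threshGraph_adj] at hab ⊢
    refine ⟨hab.1, Finset.le_max' L _ ?_⟩
    exact Finset.mem_filter.2 ⟨Finset.mem_image.2 ⟨(a, b), Finset.mem_univ _, rfl⟩, hab.2⟩

/-- **Proposition 1, part (c).** For `P` in general position there is
an injective map `f : P → ℝ²` such that for all distinct `p, q ∈ P`, the least
`δ ≥ 0` at which `p` and `q` lie in the same connected component of the
`δ`-threshold graph on `P` equals the least `δ ≥ 0` at which `f(p)` and `f(q)` lie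
in the same connected component of the `δ`-threshold graph on `f(P)`. -/
theorem topomap_preserves_merge_times {d : ℕ}
    (P : Finset (EuclideanSpace ℝ (Fin d))) (hgp : GenPos P) :
    ∃ f : EuclideanSpace ℝ (Fin d) → EuclideanSpace ℝ (Fin 2),
      Set.InjOn f ↑P ∧
      ∀ p q : P, p ≠ q →
        sInf {δ : ℝ | 0 ≤ δ ∧ (threshGraph P δ).Reachable p q} =
        sInf {δ : ℝ | 0 ≤ δ ∧ (threshGraph (P.image f) δ).Reachable
          ⟨f p, Finset.mem_image_of_mem f p.2⟩
          ⟨f q, Finset.mem_image_of_mem f q.2⟩} := by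
  choose u hu0 hu using fun p q : P => exists_merge P p q
  have hself : ∀ p q δ, u p q ≤ δ → (threshGraph P δ).Reachable p q := fun p q δ h =>
    (hu p q δ ((hu0 p q).trans h)).2 h
  have hsymm : ∀ a b, u a b = u b a := by
    intro a b
    apply le_antisymm
    · exact (hu a b _ (hu0 b a)).1 (hself b a _ le_rfl).symm
    · exact (hu b a _ (hu0 a b)).1 (hself a b _ le_rfl).symm
  have hpos : ∀ a b, a ≠ b → 0 < u a b := by
    intro a b hab
    refine lt_of_le_of_ne (hu0 a b) fun h => hab ?_
    obtain ⟨w⟩ := hself a b 0 h.ge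
    cases w with
    | nil => rfl
    | cons h' _ =>
      rw [threshGraph_adj] at h'
      exact absurd (Subtype.ext (dist_le_zero.1 h'.2)) h'.1
  have hult : ∀ a b c, u a c ≤ max (u a b) (u b c) := by
    intro a b c
    exact (hu a c _ ((hu0 a b).trans (le_max_left _ _))).1
      ((hself a b _ (le_max_left _ _)).trans (hself b c _ (le_max_right _ _)))
  obtain ⟨g, h1, h2⟩ := line_embed u hsymm hpos hult _ Finset.univ rfl
  let f : EuclideanSpace ℝ (Fin d) → EuclideanSpace ℝ (Fin 2) := fun x =>
    if h : x ∈ P then EuclideanSpace.single 0 (g ⟨x, h⟩) else 0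
  have hf : ∀ p : P, f p = EuclideanSpace.single 0 (g p) := by
    intro p; simp [f]
  have hdist : ∀ p q : P, dist (f p) (f q) = |g p - g q| := by
    intro p q
    rw [hf, hf, EuclideanSpace.dist_single_same, Real.dist_eq]
  have h1' : ∀ a b : P, a ≠ b → u a b ≤ dist (f a) (f b) := fun a b hab => by
    rw [hdist]; exact h1 a (Finset.mem_univ _) b (Finset.mem_univ _) hab
  have hinj : ∀ a b : P, f a = f b → a = b := by
    intro a b hab
    by_contra hne
    have := h1' a b hne
    rw [hab, dist_self] at this
    exact absurd (hpos a b hne) (not_lt.2 this)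
  refine ⟨f, ?_, ?_⟩
  · intro a ha b hb hab
    exact congrArg Subtype.val (hinj ⟨a, ha⟩ ⟨b, hb⟩ hab)
  · intro p q hpq
    congr 1
    ext δ
    simp only [Set.mem_setOf_eq]
    refine and_congr_right fun hδ => ?_
    rw [hu p q δ hδ]
    let F : P → (P.image f : Finset _) := fun p => ⟨f p, Finset.mem_image_of_mem f p.2⟩
    have hF : ∀ z : (P.image f : Finset _), ∃ a : P, F a = z := by
      rintro ⟨z, hz⟩
      obtain ⟨a, ha, rfl⟩ := Finset.mem_image.1 hz
      exact ⟨⟨a, ha⟩, rfl⟩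
    change _ ↔ (threshGraph (P.image f) δ).Reachable (F p) (F q)
    constructor
    · intro hle
      have hc := h2 p (Finset.mem_univ _) q (Finset.mem_univ _) hpq
      have key : ∀ b, Relation.ReflTransGen (fun x y => x ∈ (Finset.univ : Finset P) ∧
          y ∈ (Finset.univ : Finset P) ∧ |g x - g y| ≤ u p q) p b →
          (threshGraph (P.image f) δ).Reachable (F p) (F b) := by
        intro b hb
        induction hb with
        | refl => exact SimpleGraph.Reachable.refl _
        | @tail w z _ hwz ih =>
          refine ih.trans (reach_of_dist _ _ _ _ ?_)
          change dist (f w) (f z) ≤ δ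
          rw [hdist]
          exact hwz.2.2.trans hle
      exact key q hc
    · have key : ∀ x y, (threshGraph (P.image f) δ).Walk x y → ∀ a b, F a = x → F b = y →
          (threshGraph P δ).Reachable a b := by
        intro x y w
        induction w with
        | nil =>
          intro a b ha hb
          have : a = b := hinj a b (congrArg Subtype.val (ha.trans hb.symm))
          subst this
          exact SimpleGraph.Reachable.refl _
        | @cons x z y h _ ih =>
          intro a b ha hb
          obtain ⟨c, hc⟩ := hF z
          refine SimpleGraph.Reachable.trans ?_ (ih c b hc hb)
          subst ha hc
          rw [threshGraph_adj] at h
          have hac : a ≠ c := fun h' => h.1 (by rw [h'])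
          exact hself a c δ ((h1' a c hac).trans h.2)
      rintro ⟨w⟩
      exact (hu p q δ hδ).1 (key _ _ w p q rfl rfl)
end
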